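/- Let n,m ≥ 1, β > 0, let M ∈ ℝ^{n×n} and Q ∈ ℝ^{m×m} be symmetric positive definite, let U ∈ C^∞(ℝⁿ,ℝ), and let Γ, Σ ∈ ℝ^{(n+m)×(n+m)} satisfy the fluctuation–dissipation relation Γ·diag(I_n,Q) + diag(I_n,Q)·Γᵀ = ΣΣᵀ. Define the QGLE generator L acting on smooth functions φ(q,p,s) on ℝⁿ×ℝⁿ×ℝᵐ by Lφ = M⁻¹p·∇_qφ − ∇U(q)·∇_pφ − (Γ·(M⁻¹p, s))·∇_{(p,s)}φ + (β⁻¹/2)·∑_{i,j=1}^{n+m}(ΣΣᵀ)_{ij}∂_{z_i}∂_{z_j}φ, where z = (p,s). Let ρ(q,p,s) = exp(−β[U(q) + ½pᵀM⁻¹p + ½sᵀQ⁻¹s]). Then ρ is a stationary density for the QGLE in the distributional sense: for every compactly supported smooth test function φ ∈ C_c^∞(ℝ^{2n+m},ℝ), ∫_{ℝ^{2n+m}} (Lφ)(x)·ρ(x) dx = 0. (This is the invariance statement of Proposition 1.1: the QGLE conserves the extended Gibbs–Boltzmann measure with density proportional to ρ.) -/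

import Mathlib

open Matrix MeasureTheory

/-- The gradient of `U : (Fin n → ℝ) → ℝ`. -/
noncomputable def gradU {n : ℕ} (U : (Fin n → ℝ) → ℝ) (q : Fin n → ℝ) : Fin n → ℝ :=
  fun i => fderiv ℝ U q (Pi.single i 1)

/-- Partial derivative in the `i`-th coordinate direction of `g : (d → ℝ) → ℝ`. -/
noncomputable def pd {d : Type*} [Fintype d] [DecidableEq d] (i : d)
    (g : (d → ℝ) → ℝ) (x : d → ℝ) : ℝ :=
  fderiv ℝ g x (Pi.single i 1)

/-- Integrating by parts, the Fokker–Planck identity of a pair of coordinate directions. -/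
theorem integrable_pd_mul_pd_add {d : Type*} [Fintype d] [DecidableEq d]
    {φ ρ : (d → ℝ) → ℝ} (hφ : ContDiff ℝ 2 φ) (hc : HasCompactSupport φ)
    (hρ : ContDiff ℝ 1 ρ) (i j : d) :
    Integrable (fun x => pd i φ x * pd j ρ x + pd j (pd i φ) x * ρ x) ∧
      ∫ x, (pd i φ x * pd j ρ x + pd j (pd i φ) x * ρ x) = 0 := by
  have hψ : ContDiff ℝ 1 (pd i φ) :=
    (hφ.fderiv_right (m := 1) (by norm_num)).clm_apply contDiff_const
  have hψc : HasCompactSupport (pd i φ) := hc.fderiv_apply ℝ (Pi.single i 1)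
  have hψ' : Continuous (pd j (pd i φ)) :=
    (hψ.continuous_fderiv one_ne_zero).clm_apply continuous_const
  have hψc₁ : HasCompactSupport (pd j (pd i φ)) := hψc.fderiv_apply ℝ (Pi.single j 1)
  have hρ' : Continuous (pd j ρ) :=
    (hρ.continuous_fderiv one_ne_zero).clm_apply continuous_const
  have h₁ : Integrable (fun x => pd i φ x * pd j ρ x) :=
    (hψ.continuous.mul hρ').integrable_of_hasCompactSupport hψc.mul_right
  have h₂ : Integrable (fun x => pd j (pd i φ) x * ρ x) :=
    (hψ'.mul hρ.continuous).integrable_of_hasCompactSupport hψc₁.mul_right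
  have h₃ : Integrable (fun x => pd i φ x * ρ x) :=
    (hψ.continuous.mul hρ.continuous).integrable_of_hasCompactSupport hψc.mul_right
  refine ⟨h₁.add h₂, ?_⟩
  rw [integral_add h₁ h₂]
  have := integral_mul_fderiv_eq_neg_fderiv_mul_of_integrable (f := pd i φ) (g := ρ)
    (v := Pi.single j (1 : ℝ)) (μ := volume) h₂ h₁ h₃ (fun x _ => hψ.differentiable one_ne_zero x)
    (fun x _ => hρ.differentiable one_ne_zero x)
  rw [add_eq_zero_iff_eq_neg]
  exact this

/-- If `K` is a constant coefficient array, the operator `φ ↦ ∑ Kᵢⱼ (∂ᵢφ ∂ⱼρ + ∂ⱼ∂ᵢφ ρ)`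
is a divergence. -/
theorem integral_sum_pd_mul_pd_add {d : Type*} [Fintype d] [DecidableEq d]
    {φ ρ : (d → ℝ) → ℝ} (hφ : ContDiff ℝ 2 φ) (hc : HasCompactSupport φ)
    (hρ : ContDiff ℝ 1 ρ) (K : d → d → ℝ) :
    ∫ x, ∑ i, ∑ j, K i j * (pd i φ x * pd j ρ x + pd j (pd i φ) x * ρ x) = 0 := by
  have h := integrable_pd_mul_pd_add hφ hc hρ
  rw [integral_finsetSum _ fun i _ => integrable_finsetSum _ fun j _ => (h i j).1.const_mul _]
  refine Finset.sum_eq_zero fun i _ => ?_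
  rw [integral_finsetSum _ fun j _ => (h i j).1.const_mul _]
  refine Finset.sum_eq_zero fun j _ => ?_
  rw [integral_const_mul, (h i j).2, mul_zero]

theorem pd_comm {d : Type*} [Fintype d] [DecidableEq d] {φ : (d → ℝ) → ℝ}
    (hφ : ContDiff ℝ 2 φ) (i j : d) (x : d → ℝ) : pd i (pd j φ) x = pd j (pd i φ) x := by
  have hd : DifferentiableAt ℝ (fderiv ℝ φ) x :=
    (hφ.fderiv_right (m := 1) (by norm_num)).differentiable one_ne_zero x
  have key (k l : d) : pd k (pd l φ) x =
      fderiv ℝ (fderiv ℝ φ) x (Pi.single k 1) (Pi.single l 1) := by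
    change fderiv ℝ (fun y => fderiv ℝ φ y (Pi.single l 1)) x (Pi.single k 1) = _
    rw [fderiv_clm_apply hd (differentiableAt_const _)]
    simp
  rw [key, key]
  exact (hφ.contDiffAt.isSymmSndFDerivAt (by simp)) _ _

/-- The derivative of `½ vᵀAv` for a symmetric matrix `A`. -/
theorem hasFDerivAt_half_dotProduct_mulVec {E ι : Type*} [NormedAddCommGroup E]
    [NormedSpace ℝ E] [Fintype ι] {A : Matrix ι ι ℝ} (hA : A.IsSymm)
    (f : E →L[ℝ] ι → ℝ) (x : E) :
    HasFDerivAt (fun y => (1 / 2 : ℝ) * (f y ⬝ᵥ A.mulVec (f y)))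
      (∑ i, A.mulVec (f x) i • (ContinuousLinearMap.proj (R := ℝ) i).comp f) x := by
  have hf (i : ι) : HasFDerivAt (fun y => f y i)
      ((ContinuousLinearMap.proj (R := ℝ) (φ := fun _ : ι => ℝ) i).comp f) x :=
    ((ContinuousLinearMap.proj (R := ℝ) (φ := fun _ : ι => ℝ) i).comp f).hasFDerivAt
  have hAf (i : ι) : HasFDerivAt (fun y => A.mulVec (f y) i)
      ((ContinuousLinearMap.proj (R := ℝ) (φ := fun _ : ι => ℝ) i).comp
        (A.mulVecLin.toContinuousLinearMap.comp f)) x :=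
    ((ContinuousLinearMap.proj (R := ℝ) (φ := fun _ : ι => ℝ) i).comp
        (A.mulVecLin.toContinuousLinearMap.comp f)).hasFDerivAt
  have h := (HasFDerivAt.fun_sum (u := Finset.univ)
    fun i _ => (hf i).mul (hAf i)).const_mul (1 / 2 : ℝ)
  refine h.congr_fderiv (ContinuousLinearMap.ext fun v => ?_)
  have hs : f x ⬝ᵥ A.mulVec (f v) = A.mulVec (f x) ⬝ᵥ f v := by
    rw [Matrix.dotProduct_mulVec, ← Matrix.mulVec_transpose, hA.eq]
  simp only [dotProduct] at hs
  simp only [_root_.smul_apply, _root_.sum_apply, _root_.add_apply,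
    ContinuousLinearMap.comp_apply, ContinuousLinearMap.proj_apply,
    LinearMap.coe_toContinuousLinearMap', Matrix.mulVecLin_apply, smul_eq_mul,
    Finset.sum_add_distrib, hs]
  ring

/-- The gradient of a density `exp (-β H)`, with `H` the sum of a potential of the first block of
coordinates and two quadratic forms of the second and third. -/
theorem pd_exp_neg_mul_energy {ι κ τ : Type*} [Fintype ι] [Fintype κ] [Fintype τ]
    [DecidableEq ι] [DecidableEq κ] [DecidableEq τ] (β : ℝ)
    {A : Matrix κ κ ℝ} {B : Matrix τ τ ℝ} (hA : A.IsSymm) (hB : B.IsSymm)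
    {U : (ι → ℝ) → ℝ} (hU : Differentiable ℝ U) {ρ : ((ι ⊕ (κ ⊕ τ)) → ℝ) → ℝ}
    (hρ : ∀ x, ρ x = Real.exp (-β * (U (fun i => x (Sum.inl i))
      + (1 / 2) * ((fun i => x (Sum.inr (Sum.inl i))) ⬝ᵥ
          A.mulVec fun i => x (Sum.inr (Sum.inl i)))
      + (1 / 2) * ((fun j => x (Sum.inr (Sum.inr j))) ⬝ᵥ
          B.mulVec fun j => x (Sum.inr (Sum.inr j))))))
    (x : (ι ⊕ (κ ⊕ τ)) → ℝ) (k : ι ⊕ (κ ⊕ τ)) :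
    pd k ρ x = -β * Sum.elim (fun i => fderiv ℝ U (fun i => x (Sum.inl i)) (Pi.single i 1))
      (Sum.elim (A.mulVec fun i => x (Sum.inr (Sum.inl i)))
        (B.mulVec fun j => x (Sum.inr (Sum.inr j)))) k * ρ x := by
  let fq : ((ι ⊕ (κ ⊕ τ)) → ℝ) →L[ℝ] ι → ℝ :=
    ContinuousLinearMap.pi fun i => ContinuousLinearMap.proj (Sum.inl i)
  let fp : ((ι ⊕ (κ ⊕ τ)) → ℝ) →L[ℝ] κ → ℝ :=
    ContinuousLinearMap.pi fun i => ContinuousLinearMap.proj (Sum.inr (Sum.inl i))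
  let fs : ((ι ⊕ (κ ⊕ τ)) → ℝ) →L[ℝ] τ → ℝ :=
    ContinuousLinearMap.pi fun i => ContinuousLinearMap.proj (Sum.inr (Sum.inr i))
  have hq : HasFDerivAt (fun y => U (fq y)) ((fderiv ℝ U (fq x)).comp fq) x :=
    (hU (fq x)).hasFDerivAt.comp x fq.hasFDerivAt
  have h := (((hq.add (hasFDerivAt_half_dotProduct_mulVec hA fp x)).add
    (hasFDerivAt_half_dotProduct_mulVec hB fs x)).const_mul (-β)).exp
  have hρ' : HasFDerivAt ρ _ x := h.congr_of_eventuallyEq (Filter.Eventually.of_forall hρ)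
  have hv : ∀ v, fderiv ℝ ρ x v = ρ x * (-β * (fderiv ℝ U (fq x) (fq v) +
      ∑ i, A.mulVec (fp x) i * fp v i + ∑ j, B.mulVec (fs x) j * fs v j)) := by
    intro v
    rw [hρ'.fderiv, hρ x]
    simp only [_root_.smul_apply, _root_.sum_apply, _root_.add_apply, smul_eq_mul,
      ContinuousLinearMap.comp_apply, ContinuousLinearMap.proj_apply]
    rfl
  have hsingle (a b : ι ⊕ (κ ⊕ τ)) :
      (Pi.single a 1 : ι ⊕ (κ ⊕ τ) → ℝ) b = if b = a then 1 else 0 := Pi.single_apply ..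
  rw [pd, hv]
  rcases k with i | i | j
  · have e : fq (Pi.single (Sum.inl i) 1) = Pi.single i 1 := by
      ext; simp [fq, Pi.single_apply]
    rw [e]
    simp only [fp, fs, fq, ContinuousLinearMap.coe_pi', ContinuousLinearMap.proj_apply, hsingle]
    simp
    ring
  · have e : fq (Pi.single (Sum.inr (Sum.inl i)) 1) = 0 := by
      ext; simp [fq]
    rw [e]
    simp only [fp, fs, fq, ContinuousLinearMap.coe_pi', ContinuousLinearMap.proj_apply, hsingle]
    simp
    ring
  · have e : fq (Pi.single (Sum.inr (Sum.inr j)) 1) = 0 := by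
      ext; simp [fq]
    rw [e]
    simp only [fp, fs, fq, ContinuousLinearMap.coe_pi', ContinuousLinearMap.proj_apply, hsingle]
    simp
    ring

/-- A symplectic block for the first two groups of coordinates together with a matrix `G` on the
last two: the coefficients of the drift of Langevin-type equations in terms of the energy
gradient. -/
def langevinCoeff {ι τ : Type*} [DecidableEq ι] [DecidableEq τ] (G : Matrix (ι ⊕ τ) (ι ⊕ τ) ℝ) :
    ι ⊕ (ι ⊕ τ) → ι ⊕ (ι ⊕ τ) → ℝ
  | Sum.inl i, Sum.inr (Sum.inl j) => -(if i = j then 1 else 0)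
  | Sum.inl _, _ => 0
  | Sum.inr a, Sum.inl j => if a = Sum.inl j then 1 else 0
  | Sum.inr a, Sum.inr b => G a b

theorem sum_langevinCoeff_mul {ι τ : Type*} [Fintype ι] [Fintype τ] [DecidableEq ι]
    [DecidableEq τ] (G : Matrix (ι ⊕ τ) (ι ⊕ τ) ℝ) (X : ι ⊕ (ι ⊕ τ) → ι ⊕ (ι ⊕ τ) → ℝ) :
    ∑ i, ∑ j, langevinCoeff G i j * X i j =
      -∑ i, X (Sum.inl i) (Sum.inr (Sum.inl i)) + ∑ i, X (Sum.inr (Sum.inl i)) (Sum.inl i)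
        + ∑ a, ∑ b, G a b * X (Sum.inr a) (Sum.inr b) := by
  rw [Fintype.sum_sum_type]
  simp_rw [Fintype.sum_sum_type (α₁ := ι) (α₂ := ι ⊕ τ)]
  rw [Finset.sum_add_distrib, Finset.sum_add_distrib, add_assoc _ _ (∑ a, ∑ b, _)]
  congr 1
  · simp [langevinCoeff]
  · congr 1
    simp [langevinCoeff, Fintype.sum_sum_type]

/-- If `G + Gᵀ = S`, only the symmetric part `S / 2` of `G` acts on a symmetric array. -/
theorem sum_mul_eq_half_sum_mul_of_add_transpose {κ : Type*} [Fintype κ] {G S : Matrix κ κ ℝ}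
    (hS : G + Gᵀ = S) {w : κ → κ → ℝ} (hw : ∀ a b, w a b = w b a) :
    ∑ a, ∑ b, G a b * w b a = 1 / 2 * ∑ a, ∑ b, S a b * w a b := by
  have h : ∑ a, ∑ b, Gᵀ a b * w a b = ∑ a, ∑ b, G a b * w b a := by
    rw [Finset.sum_comm]; rfl
  simp only [← hS, Matrix.add_apply, add_mul, Finset.sum_add_distrib, h]
  simp only [hw]
  ring

/-- invariance part of Proposition 1.1: the extended Gibbs–Boltzmann
density `ρ(q,p,s) = exp(−β[U(q) + ½pᵀM⁻¹p + ½sᵀQ⁻¹s])` is stationary for the QGLE in the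
distributional sense: `∫ (Lφ)·ρ dx = 0` for all compactly supported smooth test functions
`φ`, where `L` is the QGLE generator
`Lφ = M⁻¹p·∇_qφ − ∇U(q)·∇_pφ − (Γ(M⁻¹p,s))·∇_{(p,s)}φ + (β⁻¹/2)∑ᵢⱼ(ΣΣᵀ)ᵢⱼ∂_{zᵢ}∂_{zⱼ}φ`,
and the fluctuation–dissipation relation `Γ·diag(I,Q) + diag(I,Q)·Γᵀ = ΣΣᵀ` holds. -/
theorem qgle_gibbs_stationary
    (n m : ℕ) (hn : 1 ≤ n) (hm : 1 ≤ m) (β : ℝ) (hβ : 0 < β)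
    (M : Matrix (Fin n) (Fin n) ℝ) (Q : Matrix (Fin m) (Fin m) ℝ)
    (hM : M.PosDef) (hQ : Q.PosDef)
    (U : (Fin n → ℝ) → ℝ) (hU : ContDiff ℝ (⊤ : ℕ∞) U)
    (Γ Sig : Matrix (Fin n ⊕ Fin m) (Fin n ⊕ Fin m) ℝ)
    (hFD : Γ * fromBlocks 1 0 0 Q + fromBlocks 1 0 0 Q * Γᵀ = Sig * Sigᵀ)
    (L : (((Fin n ⊕ (Fin n ⊕ Fin m)) → ℝ) → ℝ) → ((Fin n ⊕ (Fin n ⊕ Fin m)) → ℝ) → ℝ)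
    (hL : ∀ φ : ((Fin n ⊕ (Fin n ⊕ Fin m)) → ℝ) → ℝ, ∀ x,
      L φ x =
        (∑ i : Fin n,
            M⁻¹.mulVec (fun i' => x (Sum.inr (Sum.inl i'))) i * pd (Sum.inl i) φ x)
          - (∑ i : Fin n,
              gradU U (fun i' => x (Sum.inl i')) i * pd (Sum.inr (Sum.inl i)) φ x)
          - (∑ j : Fin n ⊕ Fin m,
              Γ.mulVec (Sum.elim (M⁻¹.mulVec fun i' => x (Sum.inr (Sum.inl i')))
                  (fun j' => x (Sum.inr (Sum.inr j')))) j * pd (Sum.inr j) φ x)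
          + (β⁻¹ / 2) * ∑ j₁ : Fin n ⊕ Fin m, ∑ j₂ : Fin n ⊕ Fin m,
              (Sig * Sigᵀ) j₁ j₂ * pd (Sum.inr j₁) (pd (Sum.inr j₂) φ) x)
    (ρ : ((Fin n ⊕ (Fin n ⊕ Fin m)) → ℝ) → ℝ)
    (hρ : ∀ x, ρ x = Real.exp (-β * (U (fun i => x (Sum.inl i))
      + (1 / 2) * ((fun i => x (Sum.inr (Sum.inl i))) ⬝ᵥ
          M⁻¹.mulVec fun i => x (Sum.inr (Sum.inl i)))
      + (1 / 2) * ((fun j => x (Sum.inr (Sum.inr j))) ⬝ᵥ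
          Q⁻¹.mulVec fun j => x (Sum.inr (Sum.inr j)))))) :
    ∀ φ : ((Fin n ⊕ (Fin n ⊕ Fin m)) → ℝ) → ℝ,
      ContDiff ℝ (⊤ : ℕ∞) φ → HasCompactSupport φ →
      ∫ x : (Fin n ⊕ (Fin n ⊕ Fin m)) → ℝ, L φ x * ρ x = 0 := by

  intro φ hφ hc
  have hφ2 : ContDiff ℝ 2 φ := contDiff_infty.1 hφ 2
  have hρC : ContDiff ℝ 1 ρ := by
    have hU1 : ContDiff ℝ 1 U := contDiff_infty.1 hU 1
    rw [funext hρ]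
    simp only [dotProduct, Matrix.mulVec]
    fun_prop
  have hMs : M⁻¹.IsSymm := by simpa using hM.inv.isHermitian
  have hQs : Q⁻¹.IsSymm := by simpa using hQ.inv.isHermitian
  have hpd := pd_exp_neg_mul_energy β hMs hQs
    (hU.differentiable (by simp)) hρ
  have hG : Γ * fromBlocks 1 0 0 Q + (Γ * fromBlocks 1 0 0 Q)ᵀ = Sig * Sigᵀ := by
    have hQt : Qᵀ = Q := by simpa using hQ.isHermitian.eq
    rw [← hFD, transpose_mul, fromBlocks_transpose, hQt]
    simp
  set G := Γ * fromBlocks 1 0 0 Q with hGdef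
  have hdrift (p : Fin n → ℝ) (s : Fin m → ℝ) :
      G.mulVec (Sum.elim p (Q⁻¹.mulVec s)) = Γ.mulVec (Sum.elim p s) := by
    have hu : IsUnit Q.det := hQ.det_pos.ne'.isUnit
    rw [hGdef, ← Matrix.mulVec_mulVec, fromBlocks_mulVec]
    simp [Matrix.mulVec_mulVec, Matrix.mul_nonsing_inv _ hu, Function.comp_def]
  have hpoint (x) : L φ x * ρ x = β⁻¹ * ∑ i, ∑ j, langevinCoeff G i j *
      (pd i φ x * pd j ρ x + pd j (pd i φ) x * ρ x) := by
    have hw := sum_mul_eq_half_sum_mul_of_add_transpose hG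
      (w := fun a b => pd (Sum.inr a) (pd (Sum.inr b) φ) x) fun a b => pd_comm hφ2 _ _ x
    have hd : ∑ a, ∑ b, G a b * (pd (Sum.inr a) φ x * pd (Sum.inr b) ρ x) =
        -β * ρ x * ∑ a, Γ.mulVec (Sum.elim (M⁻¹.mulVec fun i' => x (Sum.inr (Sum.inl i')))
          (fun j' => x (Sum.inr (Sum.inr j')))) a * pd (Sum.inr a) φ x := by
      rw [← hdrift, Finset.mul_sum]
      refine Finset.sum_congr rfl fun a _ => ?_
      rw [Matrix.mulVec, dotProduct, Finset.sum_mul, Finset.mul_sum]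
      refine Finset.sum_congr rfl fun b _ => ?_
      rw [hpd, Sum.elim_inr]
      ring
    have hcross : ∑ i : Fin n, pd (Sum.inl i) (pd (Sum.inr (Sum.inl i)) φ) x =
        ∑ i : Fin n, pd (Sum.inr (Sum.inl i)) (pd (Sum.inl i) φ) x :=
      Finset.sum_congr rfl fun i _ => pd_comm hφ2 _ _ x
    have hq : ∑ i : Fin n, pd (Sum.inl i) φ x * pd (Sum.inr (Sum.inl i)) ρ x = -β * ρ x *
        ∑ i : Fin n, M⁻¹.mulVec (fun i' => x (Sum.inr (Sum.inl i'))) i * pd (Sum.inl i) φ x := by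
      rw [Finset.mul_sum]
      refine Finset.sum_congr rfl fun i _ => ?_
      rw [hpd, Sum.elim_inr, Sum.elim_inl]
      ring
    have hp : ∑ i : Fin n, pd (Sum.inr (Sum.inl i)) φ x * pd (Sum.inl i) ρ x = -β * ρ x *
        ∑ i : Fin n, gradU U (fun i' => x (Sum.inl i')) i * pd (Sum.inr (Sum.inl i)) φ x := by
      rw [Finset.mul_sum]
      refine Finset.sum_congr rfl fun i _ => ?_
      rw [hpd, Sum.elim_inl, gradU]
      ring
    rw [sum_langevinCoeff_mul, hL]
    simp only [mul_add, ← mul_assoc (G _ _) (pd _ (pd _ _) _) (ρ x), Finset.sum_add_distrib,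
      ← Finset.sum_mul]
    rw [hd, hq, hp, hcross, hw]
    field_simp
    ring
  simp_rw [hpoint]
  rw [integral_const_mul, integral_sum_pd_mul_pd_add hφ2 hc hρC, mul_zero]
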